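/- arXiv:2508.13817 — 3 statements merged into one kernel-verified Lean document; each statement's English description precedes it below -/
import Mathlib

section
/- Let [a,b] and [c,d] be segments (integers with a ≤ b and c ≤ d), and let x = μ⁺([a,b]), y = μ⁺([c,d]) be the corresponding interval representations of Q⁺. The cokernel of the linear map Φ_{x,y} : ⊕_{i∈ℤ} Hom_ℂ(x_i, y_i) → ⊕_{i∈ℤ} Hom_ℂ(x_i, y_{i+1}), (f_i)_i ↦ (f_{i+1} ∘ T^x_i − T^y_i ∘ f_i)_i, has dimension 1 over ℂ if [a,b] ≺ [c,d] (i.e. a+1 ≤ c ≤ b+1 ≤ d), and dimension 0 otherwise. (This cokernel computes Ext¹_{Q⁺}(x,y).) -/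
/-- Dimension function of the interval representation `μ⁺([a,b])` of the quiver `Q⁺`
(vertices `ℤ`, one arrow `i → i+1`): the space at vertex `i` is `ℂ` for `a ≤ i ≤ b`
and `0` otherwise. -/
def intervalDim (a b i : ℤ) : ℕ := if a ≤ i ∧ i ≤ b then 1 else 0

/-- The structure map `T_i` of the interval representation `μ⁺([a,b])`:
the identity for `a ≤ i ≤ b - 1` and `0` otherwise. -/
noncomputable def intervalT (a b i : ℤ) :
    (Fin (intervalDim a b i) → ℂ) →ₗ[ℂ] (Fin (intervalDim a b (i + 1)) → ℂ) where
  toFun v := fun _ => if h : a ≤ i ∧ i ≤ b then v ⟨0, by simp [intervalDim, h.1, h.2]⟩ else 0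
  map_add' u v := by funext j; by_cases h : a ≤ i ∧ i ≤ b <;> simp [h]
  map_smul' c v := by funext j; by_cases h : a ≤ i ∧ i ≤ b <;> simp [h]

/-- The linear map `Φ_{x,y} : ⊕_i Hom(V_i, W_i) → ⊕_i Hom(V_i, W_{i+1})`,
`(f_i)_i ↦ (f_{i+1} ∘ S_i − S'_i ∘ f_i)_i`, whose cokernel computes `Ext¹_{Q⁺}(x,y)`
for representations `x = (V,S)` and `y = (W,S')` of `Q⁺`. -/
def QPhi (V W : ℤ → Type) [∀ i, AddCommGroup (V i)] [∀ i, Module ℂ (V i)]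
    [∀ i, AddCommGroup (W i)] [∀ i, Module ℂ (W i)]
    (S : ∀ i, V i →ₗ[ℂ] V (i + 1)) (S' : ∀ i, W i →ₗ[ℂ] W (i + 1)) :
    (∀ i, V i →ₗ[ℂ] W i) →ₗ[ℂ] (∀ i, V i →ₗ[ℂ] W (i + 1)) where
  toFun f := fun i => (f (i + 1)).comp (S i) - (S' i).comp (f i)
  map_add' f g := by
    funext i
    simp only [Pi.add_apply, LinearMap.add_comp, LinearMap.comp_add]
    abel
  map_smul' c f := by
    funext i
    simp [LinearMap.smul_comp, LinearMap.comp_smul, smul_sub]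

/-- The sum of the values of a linear map between coordinate spaces at the all-ones vector. -/
noncomputable def onesSum (m n : ℕ) : ((Fin m → ℂ) →ₗ[ℂ] (Fin n → ℂ)) →ₗ[ℂ] ℂ where
  toFun f := ∑ j, f 1 j
  map_add' f g := by simp [Finset.sum_add_distrib]
  map_smul' r f := by simp [Finset.mul_sum]

/-- The linear map all of whose matrix coefficients are equal to `r`. -/
noncomputable def constMap (m n : ℕ) (r : ℂ) : (Fin m → ℂ) →ₗ[ℂ] (Fin n → ℂ) where
  toFun v := fun _ => r * ∑ j, v j
  map_add' u v := by funext j; simp [Finset.sum_add_distrib, mul_add]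
  map_smul' c v := by funext j; simp [← Finset.mul_sum, mul_left_comm]

theorem onesSum_constMap (m n : ℕ) (r : ℂ) :
    onesSum m n (constMap m n r) = n * (r * m) := by
  simp [onesSum, constMap]

theorem onesSum_injective {m n : ℕ} (hm : m ≤ 1) (hn : n ≤ 1) :
    Function.Injective (onesSum m n) := by
  rw [← LinearMap.ker_eq_bot, LinearMap.ker_eq_bot']
  intro f hf
  interval_cases m
  · ext i; exact i.elim0
  interval_cases n
  · ext i j; exact j.elim0
  ext i j
  fin_cases i; fin_cases j
  have h1 : (Pi.single 0 1 : Fin 1 → ℂ) = 1 := by ext k; fin_cases k; rfl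
  simpa [onesSum, h1] using hf

theorem intervalDim_le_one (a b i : ℤ) : intervalDim a b i ≤ 1 := by
  unfold intervalDim; split_ifs <;> simp

theorem intervalDim_eq_one {a b i : ℤ} (h : a ≤ i ∧ i ≤ b) : intervalDim a b i = 1 := if_pos h

theorem intervalDim_eq_zero {a b i : ℤ} (h : ¬ (a ≤ i ∧ i ≤ b)) : intervalDim a b i = 0 :=
  if_neg h

theorem onesSum_eq_zero {m n : ℕ} (h : m = 0 ∨ n = 0)
    (f : (Fin m → ℂ) →ₗ[ℂ] (Fin n → ℂ)) : onesSum m n f = 0 := by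
  rcases h with rfl | rfl
  · have h1 : (1 : Fin 0 → ℂ) = 0 := Subsingleton.elim _ _
    have h2 : f 1 = 0 := by rw [h1, map_zero]
    simp only [onesSum, LinearMap.coe_mk, AddHom.coe_mk, h2, Pi.zero_apply, Finset.sum_const_zero]
  · simp [onesSum]

theorem onesSum_intervalDim_eq_zero {a b c d i k : ℤ}
    (h : ¬ ((a ≤ i ∧ i ≤ b) ∧ (c ≤ k ∧ k ≤ d)))
    (f : (Fin (intervalDim a b i) → ℂ) →ₗ[ℂ] (Fin (intervalDim c d k) → ℂ)) :
    onesSum _ _ f = 0 := by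
  apply onesSum_eq_zero
  by_cases h1 : a ≤ i ∧ i ≤ b
  · exact Or.inr (intervalDim_eq_zero fun h2 => h ⟨h1, h2⟩)
  · exact Or.inl (intervalDim_eq_zero h1)

theorem intervalT_one {a b i : ℤ} (h : a ≤ i ∧ i ≤ b) : intervalT a b i 1 = 1 := by
  funext j; simp [intervalT, h]

theorem sum_intervalT {c d i : ℤ} (h : c ≤ i + 1 ∧ i + 1 ≤ d)
    (v : Fin (intervalDim c d i) → ℂ) : ∑ j, intervalT c d i v j = ∑ j, v j := by
  by_cases hi : c ≤ i ∧ i ≤ d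
  · have key : ∀ (n : ℕ) (hn : n = 1) (w : Fin n → ℂ), ∑ j, w j = w ⟨0, by omega⟩ := by
      rintro n rfl w; simp
    rw [key _ (intervalDim_eq_one hi) v]
    simp [intervalT, hi, intervalDim_eq_one h]
  · have key : ∀ (n : ℕ) (_ : n = 0) (w : Fin n → ℂ), ∑ j, w j = 0 := by
      rintro n rfl w; simp
    rw [key _ (intervalDim_eq_zero hi) v]
    simp [intervalT, hi]

/-- The map `Φ` between two interval representations. -/
noncomputable abbrev intervalPhi (a b c d : ℤ) :=
  QPhi (fun i => Fin (intervalDim a b i) → ℂ) (fun i => Fin (intervalDim c d i) → ℂ)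
    (intervalT a b) (intervalT c d)

theorem onesSum_intervalPhi {a b c d i : ℤ} (h : (a ≤ i ∧ i ≤ b) ∧ (c ≤ i + 1 ∧ i + 1 ≤ d))
    (f : ∀ i, (Fin (intervalDim a b i) → ℂ) →ₗ[ℂ] (Fin (intervalDim c d i) → ℂ)) :
    onesSum _ _ (intervalPhi a b c d f i) = onesSum _ _ (f (i + 1)) - onesSum _ _ (f i) := by
  simp only [intervalPhi, QPhi, LinearMap.coe_mk, AddHom.coe_mk, map_sub]
  simp [onesSum, intervalT_one h.1, sum_intervalT h.2]

/-- A family lies in the range of `Φ` as soon as its coefficients are the differences of a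
function supported on the intersection of the two segments. -/
theorem mem_range_intervalPhi {a b c d : ℤ}
    (g : ∀ i : ℤ, (Fin (intervalDim a b i) → ℂ) →ₗ[ℂ] (Fin (intervalDim c d (i + 1)) → ℂ))
    (F : ℤ → ℂ) (hF : ∀ i, ¬ ((a ≤ i ∧ i ≤ b) ∧ (c ≤ i ∧ i ≤ d)) → F i = 0)
    (hg : ∀ i, (a ≤ i ∧ i ≤ b) ∧ (c ≤ i + 1 ∧ i + 1 ≤ d) →
      F (i + 1) - F i = onesSum _ _ (g i)) :
    g ∈ LinearMap.range (intervalPhi a b c d) := by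
  have hsum : ∀ i, onesSum _ _ (constMap (intervalDim a b i) (intervalDim c d i) (F i)) = F i := by
    intro i
    by_cases h : (a ≤ i ∧ i ≤ b) ∧ (c ≤ i ∧ i ≤ d)
    · simp [onesSum_constMap, intervalDim_eq_one h.1, intervalDim_eq_one h.2]
    · rw [onesSum_intervalDim_eq_zero h, hF i h]
  refine ⟨fun i => constMap _ _ (F i), funext fun i => ?_⟩
  apply onesSum_injective (intervalDim_le_one _ _ _) (intervalDim_le_one _ _ _)
  by_cases h : (a ≤ i ∧ i ≤ b) ∧ (c ≤ i + 1 ∧ i + 1 ≤ d)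
  · rw [onesSum_intervalPhi h, hsum, hsum, hg i h]
  · rw [onesSum_intervalDim_eq_zero h, onesSum_intervalDim_eq_zero h]

theorem Int.sum_Ico_add_one {m n : ℤ} (h : m ≤ n) (g : ℤ → ℂ) :
    ∑ j ∈ Finset.Ico m (n + 1), g j = ∑ j ∈ Finset.Ico m n, g j + g n := by
  rw [← Finset.insert_Ico_right_eq_Ico_add_one h, Finset.sum_insert (by simp), add_comm]

theorem Int.sum_Ico_eq_add_sum_Ico_add_one {m n : ℤ} (h : m < n) (g : ℤ → ℂ) :
    ∑ j ∈ Finset.Ico m n, g j = g m + ∑ j ∈ Finset.Ico (m + 1) n, g j := by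
  rw [← Finset.insert_Ico_add_one_left_eq_Ico h, Finset.sum_insert (by simp)]

theorem Int.sum_Ico_sub {m n : ℤ} (h : m ≤ n) (F : ℤ → ℂ) :
    ∑ j ∈ Finset.Ico m n, (F (j + 1) - F j) = F n - F m := by
  induction n, h using Int.leInduction with
  | base => simp
  | succ n hn ih => rw [Int.sum_Ico_add_one hn, ih]; ring

theorem range_intervalPhi_eq_top {a b c d : ℤ} (h : ¬ (a + 1 ≤ c ∧ c ≤ b + 1 ∧ b + 1 ≤ d)) :
    LinearMap.range (intervalPhi a b c d) = ⊤ := by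
  rw [eq_top_iff]
  intro g _
  by_cases hdb : d ≤ b
  · apply mem_range_intervalPhi g (fun i => if (a ≤ i ∧ i ≤ b) ∧ (c ≤ i ∧ i ≤ d) then
      ∑ j ∈ Finset.Ico (c - 1) i, onesSum _ _ (g j) else 0) (fun i hi => if_neg hi)
    intro i hi
    rw [if_pos (by omega), Int.sum_Ico_add_one (by omega)]
    split_ifs with h1
    · ring
    · obtain rfl : i = c - 1 := by omega
      simp
  · apply mem_range_intervalPhi g (fun i => if (a ≤ i ∧ i ≤ b) ∧ (c ≤ i ∧ i ≤ d) then
      -∑ j ∈ Finset.Ico i (b + 1), onesSum _ _ (g j) else 0) (fun i hi => if_neg hi)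
    intro i hi
    rw [if_pos (c := (a ≤ i ∧ i ≤ b) ∧ (c ≤ i ∧ i ≤ d)) (by omega),
      Int.sum_Ico_eq_add_sum_Ico_add_one (m := i) (by omega)]
    split_ifs with h1
    · ring
    · obtain rfl : i = b := by omega
      simp

/-- The sum of all coefficients of a family of linear maps at the vertices `c - 1, …, b`. -/
noncomputable def coeffSum (a b c d : ℤ) :
    (∀ i : ℤ, (Fin (intervalDim a b i) → ℂ) →ₗ[ℂ] (Fin (intervalDim c d (i + 1)) → ℂ)) →ₗ[ℂ] ℂ :=
  ∑ j ∈ Finset.Ico (c - 1) (b + 1), (onesSum _ _).comp (LinearMap.proj j)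

theorem coeffSum_apply (a b c d : ℤ)
    (g : ∀ i : ℤ, (Fin (intervalDim a b i) → ℂ) →ₗ[ℂ] (Fin (intervalDim c d (i + 1)) → ℂ)) :
    coeffSum a b c d g = ∑ j ∈ Finset.Ico (c - 1) (b + 1), onesSum _ _ (g j) := by
  simp [coeffSum]

theorem range_intervalPhi_eq_ker {a b c d : ℤ} (h : a + 1 ≤ c ∧ c ≤ b + 1 ∧ b + 1 ≤ d) :
    LinearMap.range (intervalPhi a b c d) = LinearMap.ker (coeffSum a b c d) := by
  apply le_antisymm
  · rintro _ ⟨f, rfl⟩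
    rw [LinearMap.mem_ker, coeffSum_apply]
    rw [Finset.sum_congr rfl fun j hj =>
      onesSum_intervalPhi (by rw [Finset.mem_Ico] at hj; omega) f]
    rw [Int.sum_Ico_sub (by omega) fun j => onesSum _ _ (f j),
      onesSum_intervalDim_eq_zero (by omega), onesSum_intervalDim_eq_zero (by omega), sub_zero]
  · intro g hg
    rw [LinearMap.mem_ker, coeffSum_apply] at hg
    apply mem_range_intervalPhi g (fun i => if (a ≤ i ∧ i ≤ b) ∧ (c ≤ i ∧ i ≤ d) then
      ∑ j ∈ Finset.Ico (c - 1) i, onesSum _ _ (g j) else 0) (fun i hi => if_neg hi)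
    have key : ∀ i, c - 1 ≤ i → i ≤ b + 1 →
        (if (a ≤ i ∧ i ≤ b) ∧ (c ≤ i ∧ i ≤ d) then
          ∑ j ∈ Finset.Ico (c - 1) i, onesSum _ _ (g j) else 0) =
        ∑ j ∈ Finset.Ico (c - 1) i, onesSum _ _ (g j) := by
      intro i h1 h2
      split_ifs with h3
      · rfl
      · obtain rfl | rfl : i = c - 1 ∨ i = b + 1 := by omega
        · simp
        · exact hg.symm
    intro i hi
    rw [key i (by omega) (by omega), key (i + 1) (by omega) (by omega),
      Int.sum_Ico_add_one (by omega)]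
    ring

theorem coeffSum_surjective {a b c d : ℤ} (h : a + 1 ≤ c ∧ c ≤ b + 1 ∧ b + 1 ≤ d) (hab : a ≤ b) :
    Function.Surjective (coeffSum a b c d) := by
  refine fun r => ⟨fun i => constMap _ _ (if i = b then r else 0), ?_⟩
  simp only [coeffSum_apply, onesSum_constMap]
  rw [Finset.sum_eq_single b]
  · simp [intervalDim_eq_one (show a ≤ b ∧ b ≤ b by omega),
      intervalDim_eq_one (show c ≤ b + 1 ∧ b + 1 ≤ d by omega)]
  · intro j _ hj
    simp [hj]
  · intro hb
    exact absurd (Finset.mem_Ico.2 (by omega)) hb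


/-- The cokernel of `Φ_{μ⁺([a,b]), μ⁺([c,d])}` (which computes
`Ext¹_{Q⁺}(μ⁺([a,b]), μ⁺([c,d]))`) has dimension `1` over `ℂ` if `[a,b] ≺ [c,d]`
(i.e. `a+1 ≤ c ≤ b+1 ≤ d`), and dimension `0` otherwise. -/
theorem ext_between_interval_reps (a b c d : ℤ) (hab : a ≤ b) (hcd : c ≤ d) :
    Module.finrank ℂ
      ((∀ i : ℤ, (Fin (intervalDim a b i) → ℂ) →ₗ[ℂ] (Fin (intervalDim c d (i + 1)) → ℂ)) ⧸
        LinearMap.range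
          (QPhi (fun i => Fin (intervalDim a b i) → ℂ) (fun i => Fin (intervalDim c d i) → ℂ)
            (intervalT a b) (intervalT c d))) =
      if a + 1 ≤ c ∧ c ≤ b + 1 ∧ b + 1 ≤ d then 1 else 0 := by
  split_ifs with h
  · rw [range_intervalPhi_eq_ker h,
      ((coeffSum a b c d).quotKerEquivOfSurjective (coeffSum_surjective h hab)).finrank_eq,
      Module.finrank_self]
  · rw [range_intervalPhi_eq_top h]
    exact Module.finrank_zero_of_subsingleton
end

section
/- Let Δ_1,…,Δ_k and Γ_1,…,Γ_l be Speh families of segments (k, l ≥ 1), with associated sets X, Y, relation ⇝, and let M be the maximum cardinality of I over all matching functions (I,f). Then #Y − M = min( #{j ∈ {1,…,l} : ⃗Γ_j ≺ Δ_1}, #{i ∈ {1,…,k} : ⃗Γ_l ≺ Δ_i} ). -/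
/-- A segment `[a,b]`: a pair of integers with `a ≤ b`. -/
structure Segment where
  a : ℤ
  b : ℤ
  le : a ≤ b

/-- The segment `Δ` precedes the segment `Γ`, written `Δ ≺ Γ`:
`Δ.a + 1 ≤ Γ.a`, `Γ.a ≤ Δ.b + 1` and `Δ.b + 1 ≤ Γ.b`. -/
def Segment.prec (Δ Γ : Segment) : Prop :=
  Δ.a + 1 ≤ Γ.a ∧ Γ.a ≤ Δ.b + 1 ∧ Δ.b + 1 ≤ Γ.b

instance (Δ Γ : Segment) : Decidable (Δ.prec Γ) :=
  inferInstanceAs (Decidable (_ ∧ _ ∧ _))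

/-- The shift `⃗[a,b] = [a-1, b-1]` of a segment. -/
def Segment.shift (Δ : Segment) : Segment :=
  ⟨Δ.a - 1, Δ.b - 1, by have := Δ.le; omega⟩

/-- `X := {(i,j) ∈ {1,…,l} × {1,…,k} : Γ_i ≺ Δ_j}`. -/
def Xset (k l : ℕ) (Δ Γ : ℕ → Segment) : Finset (ℕ × ℕ) :=
  (Finset.Icc 1 l ×ˢ Finset.Icc 1 k).filter fun p => (Γ p.1).prec (Δ p.2)

/-- `Y := {(i,j) ∈ {1,…,l} × {1,…,k} : ⃗Γ_i ≺ Δ_j}`. -/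
def Yset (k l : ℕ) (Δ Γ : ℕ → Segment) : Finset (ℕ × ℕ) :=
  (Finset.Icc 1 l ×ˢ Finset.Icc 1 k).filter fun p => ((Γ p.1).shift).prec (Δ p.2)

/-- The relation `(r,s) ⇝ (r',s')`: either `r = r'` and `Δ_s ≺ Δ_{s'}`,
or `s = s'` and `Γ_{r'} ≺ Γ_r`. -/
def LeadsTo (Δ Γ : ℕ → Segment) (p q : ℕ × ℕ) : Prop :=
  (p.1 = q.1 ∧ (Δ p.2).prec (Δ q.2)) ∨ (p.2 = q.2 ∧ (Γ q.1).prec (Γ p.1))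

/-- A matching function `(I, f)`: a subset `I ⊆ X` together with a function `f` that is
injective on `I`, maps `I` into `Y`, and satisfies `f p ⇝ p` for all `p ∈ I`. -/
def IsMatching (k l : ℕ) (Δ Γ : ℕ → Segment) (I : Finset (ℕ × ℕ)) (f : ℕ × ℕ → ℕ × ℕ) :
    Prop :=
  I ⊆ Xset k l Δ Γ ∧ Set.InjOn f I ∧ ∀ p ∈ I, f p ∈ Yset k l Δ Γ ∧ LeadsTo Δ Γ (f p) p

/-- The maximal cardinality of `I` over all matching functions `(I, f)`. -/
noncomputable def maxMatching (k l : ℕ) (Δ Γ : ℕ → Segment) : ℕ :=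
  sSup {n | ∃ I f, IsMatching k l Δ Γ I f ∧ I.card = n}

/-- Endpoints of the members of a Speh family. -/
theorem speh_endpoints {k : ℕ} {Δ : ℕ → Segment}
    (hΔ : ∀ i, 1 ≤ i → i < k → Δ (i + 1) = (Δ i).shift) {i : ℕ} (hi : 1 ≤ i) (hik : i ≤ k) :
    (Δ i).a = (Δ 1).a + 1 - i ∧ (Δ i).b = (Δ 1).b + 1 - i := by
  induction i, hi using Nat.le_induction with
  | base => simp
  | succ n hn ih =>
    obtain ⟨ha, hb⟩ := ih (by omega)
    rw [hΔ n hn (by omega)]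
    simp only [Segment.shift]
    push_cast
    omega

/-- `Y` is the part of the grid lying in a diagonal band. -/
theorem mem_Yset_iff {k l : ℕ} {Δ Γ : ℕ → Segment}
    (hΔ : ∀ i, 1 ≤ i → i < k → Δ (i + 1) = (Δ i).shift)
    (hΓ : ∀ j, 1 ≤ j → j < l → Γ (j + 1) = (Γ j).shift) (r s : ℕ) :
    (r, s) ∈ Yset k l Δ Γ ↔ (1 ≤ r ∧ r ≤ l) ∧ (1 ≤ s ∧ s ≤ k) ∧
      (Γ 1).a - (Δ 1).a ≤ r - s ∧ (Γ 1).b - (Δ 1).b ≤ r - s ∧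
      (r - s : ℤ) ≤ (Γ 1).b - (Δ 1).a := by
  simp only [Yset, Finset.mem_filter, Finset.mem_product, Finset.mem_Icc, and_assoc]
  refine and_congr_right fun h1 => and_congr_right fun h2 => and_congr_right fun h3 =>
    and_congr_right fun h4 => ?_
  have hd := speh_endpoints hΔ h3 h4
  have hg := speh_endpoints hΓ h1 h2
  simp only [Segment.prec, Segment.shift]
  omega

/-- `X` is the part of the grid lying in the diagonal band of `Y` shifted by one. -/
theorem mem_Xset_iff {k l : ℕ} {Δ Γ : ℕ → Segment}
    (hΔ : ∀ i, 1 ≤ i → i < k → Δ (i + 1) = (Δ i).shift)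
    (hΓ : ∀ j, 1 ≤ j → j < l → Γ (j + 1) = (Γ j).shift) (r s : ℕ) :
    (r, s) ∈ Xset k l Δ Γ ↔ (1 ≤ r ∧ r ≤ l) ∧ (1 ≤ s ∧ s ≤ k) ∧
      (Γ 1).a - (Δ 1).a + 1 ≤ r - s ∧ (Γ 1).b - (Δ 1).b + 1 ≤ r - s ∧
      (r - s : ℤ) ≤ (Γ 1).b - (Δ 1).a + 1 := by
  simp only [Xset, Finset.mem_filter, Finset.mem_product, Finset.mem_Icc, and_assoc]
  refine and_congr_right fun h1 => and_congr_right fun h2 => and_congr_right fun h3 =>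
    and_congr_right fun h4 => ?_
  have hd := speh_endpoints hΔ h3 h4
  have hg := speh_endpoints hΓ h1 h2
  simp only [Segment.prec]
  omega

/-- Along `⇝` the level `r - s` strictly increases. -/
theorem LeadsTo.level_lt {k l : ℕ} {Δ Γ : ℕ → Segment}
    (hΔ : ∀ i, 1 ≤ i → i < k → Δ (i + 1) = (Δ i).shift)
    (hΓ : ∀ j, 1 ≤ j → j < l → Γ (j + 1) = (Γ j).shift) {p q : ℕ × ℕ}
    (hp : p ∈ Yset k l Δ Γ) (hq : q ∈ Xset k l Δ Γ) (h : LeadsTo Δ Γ p q) :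
    (p.1 - p.2 : ℤ) < q.1 - q.2 := by
  obtain ⟨r, s⟩ := p
  obtain ⟨r', s'⟩ := q
  rw [mem_Yset_iff hΔ hΓ] at hp
  rw [mem_Xset_iff hΔ hΓ] at hq
  obtain ⟨⟨h1, h2⟩, ⟨h3, h4⟩, -⟩ := hp
  obtain ⟨⟨h5, h6⟩, ⟨h7, h8⟩, -⟩ := hq
  have := speh_endpoints hΔ h3 h4
  have := speh_endpoints hΔ h7 h8
  have := speh_endpoints hΓ h1 h2
  have := speh_endpoints hΓ h5 h6
  simp only [LeadsTo, Segment.prec] at h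
  omega

/-- A member of a Speh family is preceded by the next one. -/
theorem speh_prec {k : ℕ} {Δ : ℕ → Segment}
    (hΔ : ∀ i, 1 ≤ i → i < k → Δ (i + 1) = (Δ i).shift) {i : ℕ} (hi : 1 ≤ i) (hik : i < k) :
    (Δ (i + 1)).prec (Δ i) := by
  have := (Δ i).le
  rw [hΔ i hi hik]
  simp only [Segment.prec, Segment.shift]
  omega

theorem IsMatching.card_le_maxMatching {k l : ℕ} {Δ Γ : ℕ → Segment} {I : Finset (ℕ × ℕ)}
    {f : ℕ × ℕ → ℕ × ℕ} (h : IsMatching k l Δ Γ I f) : I.card ≤ maxMatching k l Δ Γ := by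
  refine le_csSup ⟨(Xset k l Δ Γ).card, ?_⟩ ⟨I, f, h, rfl⟩
  rintro n ⟨J, g, hJ, rfl⟩
  exact Finset.card_le_card hJ.1

theorem exists_isMatching_card_eq_maxMatching (k l : ℕ) (Δ Γ : ℕ → Segment) :
    ∃ I f, IsMatching k l Δ Γ I f ∧ I.card = maxMatching k l Δ Γ := by
  refine Nat.sSup_mem (s := {n | ∃ I f, IsMatching k l Δ Γ I f ∧ I.card = n})
    ⟨0, ∅, id, ⟨by simp, by simp, by simp⟩, rfl⟩ ⟨(Xset k l Δ Γ).card, ?_⟩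
  rintro n ⟨J, g, hJ, rfl⟩
  exact Finset.card_le_card hJ.1

/-- Matching along rows towards smaller column index misses only the first column. -/
theorem card_Yset_le_add_first_column {k l : ℕ} {Δ Γ : ℕ → Segment}
    (hΔ : ∀ i, 1 ≤ i → i < k → Δ (i + 1) = (Δ i).shift)
    (hΓ : ∀ j, 1 ≤ j → j < l → Γ (j + 1) = (Γ j).shift) :
    (Yset k l Δ Γ).card ≤
      maxMatching k l Δ Γ + ((Yset k l Δ Γ).filter fun p => p.2 = 1).card := by
  classical
  let f : ℕ × ℕ → ℕ × ℕ := fun p => (p.1, p.2 + 1)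
  let I := (Xset k l Δ Γ).filter fun p => f p ∈ Yset k l Δ Γ
  have hI : IsMatching k l Δ Γ I f := by
    refine ⟨Finset.filter_subset _ _, ?_, ?_⟩
    · rintro ⟨r, s⟩ - ⟨r', s'⟩ - h
      simp only [f, Prod.mk.injEq] at h ⊢
      omega
    · rintro ⟨r, s⟩ h
      obtain ⟨hX, hY⟩ := Finset.mem_filter.1 h
      refine ⟨hY, Or.inl ⟨rfl, speh_prec hΔ ?_ ?_⟩⟩
      · exact ((mem_Xset_iff hΔ hΓ _ _).1 hX).2.1.1
      · exact ((mem_Yset_iff hΔ hΓ _ _).1 hY).2.1.2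
  calc (Yset k l Δ Γ).card
      ≤ (I.image f ∪ (Yset k l Δ Γ).filter fun p => p.2 = 1).card := by
        refine Finset.card_le_card ?_
        rintro ⟨r, s⟩ h
        by_cases hs : s = 1
        · exact Finset.mem_union_right _ (Finset.mem_filter.2 ⟨h, hs⟩)
        · refine Finset.mem_union_left _ (Finset.mem_image.2 ⟨(r, s - 1), ?_, ?_⟩)
          · have h' := (mem_Yset_iff hΔ hΓ _ _).1 h
            have hf : f (r, s - 1) = (r, s) := by
              simp only [f, Prod.mk.injEq, true_and]
              omega
            refine Finset.mem_filter.2 ⟨(mem_Xset_iff hΔ hΓ _ _).2 ?_, hf ▸ h⟩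
            omega
          · have h' := (mem_Yset_iff hΔ hΓ _ _).1 h
            simp only [f, Prod.mk.injEq, true_and]
            omega
    _ ≤ _ := (Finset.card_union_le _ _).trans
        (Nat.add_le_add_right (Finset.card_image_le.trans hI.card_le_maxMatching) _)

/-- Matching along columns towards larger row index misses only the last row. -/
theorem card_Yset_le_add_last_row {k l : ℕ} {Δ Γ : ℕ → Segment}
    (hΔ : ∀ i, 1 ≤ i → i < k → Δ (i + 1) = (Δ i).shift)
    (hΓ : ∀ j, 1 ≤ j → j < l → Γ (j + 1) = (Γ j).shift) :
    (Yset k l Δ Γ).card ≤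
      maxMatching k l Δ Γ + ((Yset k l Δ Γ).filter fun p => p.1 = l).card := by
  classical
  let f : ℕ × ℕ → ℕ × ℕ := fun p => (p.1 - 1, p.2)
  let I := (Xset k l Δ Γ).filter fun p => f p ∈ Yset k l Δ Γ
  have hI : IsMatching k l Δ Γ I f := by
    refine ⟨Finset.filter_subset _ _, ?_, ?_⟩
    · rintro ⟨r, s⟩ h1 ⟨r', s'⟩ h2 h
      have h1' := (mem_Yset_iff hΔ hΓ _ _).1 (Finset.mem_filter.1 h1).2
      have h2' := (mem_Yset_iff hΔ hΓ _ _).1 (Finset.mem_filter.1 h2).2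
      simp only [f, Prod.mk.injEq] at h h1' h2' ⊢
      omega
    · rintro ⟨r, s⟩ h
      obtain ⟨hX, hY⟩ := Finset.mem_filter.1 h
      have hX' := (mem_Xset_iff hΔ hΓ _ _).1 hX
      have hY' := (mem_Yset_iff hΔ hΓ _ _).1 hY
      have hr : r = r - 1 + 1 := by omega
      refine ⟨hY, Or.inr ⟨rfl, ?_⟩⟩
      have := speh_prec hΓ hY'.1.1 (by simp only; omega)
      simp only at this
      rwa [← hr] at this
  calc (Yset k l Δ Γ).card
      ≤ (I.image f ∪ (Yset k l Δ Γ).filter fun p => p.1 = l).card := by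
        refine Finset.card_le_card ?_
        rintro ⟨r, s⟩ h
        by_cases hr : r = l
        · exact Finset.mem_union_right _ (Finset.mem_filter.2 ⟨h, hr⟩)
        · refine Finset.mem_union_left _ (Finset.mem_image.2 ⟨(r + 1, s), ?_, rfl⟩)
          have h' := (mem_Yset_iff hΔ hΓ _ _).1 h
          refine Finset.mem_filter.2 ⟨(mem_Xset_iff hΔ hΓ _ _).2 ?_, h⟩
          omega
    _ ≤ _ := (Finset.card_union_le _ _).trans
        (Nat.add_le_add_right (Finset.card_image_le.trans hI.card_le_maxMatching) _)

/-- If the part of `X` of level above `c` injects into the part of `Y` of level at least `c`,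
avoiding `T`, then every matching misses at least `#T` elements of `Y`. -/
theorem maxMatching_add_card_le {k l : ℕ} {Δ Γ : ℕ → Segment}
    (hΔ : ∀ i, 1 ≤ i → i < k → Δ (i + 1) = (Δ i).shift)
    (hΓ : ∀ j, 1 ≤ j → j < l → Γ (j + 1) = (Γ j).shift) (c : ℤ) (g : ℕ × ℕ → ℕ × ℕ)
    (T : Finset (ℕ × ℕ))
    (hginj : Set.InjOn g {p | p ∈ Xset k l Δ Γ ∧ c < p.1 - p.2})
    (hg : ∀ p ∈ Xset k l Δ Γ, c < p.1 - p.2 →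
      g p ∈ Yset k l Δ Γ ∧ c ≤ (g p).1 - (g p).2 ∧ g p ∉ T)
    (hT : ∀ p ∈ T, p ∈ Yset k l Δ Γ ∧ c ≤ p.1 - p.2) :
    maxMatching k l Δ Γ + T.card ≤ (Yset k l Δ Γ).card := by
  classical
  obtain ⟨I, f, ⟨hIX, hinj, hf⟩, hcard⟩ := exists_isMatching_card_eq_maxMatching k l Δ Γ
  rw [← hcard]
  have hlev : ∀ p ∈ I, c ≤ (f p).1 - (f p).2 → c < p.1 - p.2 := fun p hp h =>
    h.trans_lt ((hf p hp).2.level_lt hΔ hΓ (hf p hp).1 (hIX hp))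
  let h : ℕ × ℕ → ℕ × ℕ := fun p => if c ≤ (f p).1 - (f p).2 then g p else f p
  have hh : Set.InjOn h I := by
    intro p hp q hq hpq
    simp only [h] at hpq
    split_ifs at hpq with h1 h2 h2
    · exact hginj ⟨hIX hp, hlev p hp h1⟩ ⟨hIX hq, hlev q hq h2⟩ hpq
    · exact absurd (hpq ▸ (hg p (hIX hp) (hlev p hp h1)).2.1) h2
    · exact absurd (hpq ▸ (hg q (hIX hq) (hlev q hq h2)).2.1) h1
    · exact hinj hp hq hpq
  have hmem : ∀ p ∈ I, h p ∈ Yset k l Δ Γ ∧ h p ∉ T := by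
    intro p hp
    simp only [h]
    split_ifs with h1
    · exact ⟨(hg p (hIX hp) (hlev p hp h1)).1, (hg p (hIX hp) (hlev p hp h1)).2.2⟩
    · exact ⟨(hf p hp).1, fun hpT => h1 (hT _ hpT).2⟩
  rw [← Finset.card_image_of_injOn hh, ← Finset.card_union_of_disjoint]
  · refine Finset.card_le_card (Finset.union_subset ?_ fun p hp => (hT p hp).1)
    exact Finset.image_subset_iff.2 fun p hp => (hmem p hp).1
  · rw [Finset.disjoint_left]
    intro q hq
    obtain ⟨p, hp, rfl⟩ := Finset.mem_image.1 hq
    exact (hmem p hp).2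

theorem card_filter_Yset_first_column {k : ℕ} (hk : 1 ≤ k) (l : ℕ) (Δ Γ : ℕ → Segment) :
    ((Yset k l Δ Γ).filter fun p => p.2 = 1).card =
      ((Finset.Icc 1 l).filter fun j => ((Γ j).shift).prec (Δ 1)).card := by
  refine Finset.card_bij' (fun p _ => p.1) (fun j _ => (j, 1)) ?_ ?_ ?_ ?_ <;>
    simp only [Yset, Finset.mem_filter, Finset.mem_product, Finset.mem_Icc] <;> grind

theorem card_filter_Yset_last_row {l : ℕ} (hl : 1 ≤ l) (k : ℕ) (Δ Γ : ℕ → Segment) :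
    ((Yset k l Δ Γ).filter fun p => p.1 = l).card =
      ((Finset.Icc 1 k).filter fun i => ((Γ l).shift).prec (Δ i)).card := by
  refine Finset.card_bij' (fun p _ => p.2) (fun i _ => (l, i)) ?_ ?_ ?_ ?_ <;>
    simp only [Yset, Finset.mem_filter, Finset.mem_product, Finset.mem_Icc] <;> grind

/-- Let `Δ_1, …, Δ_k` and `Γ_1, …, Γ_l` (`k, l ≥ 1`) be Speh families of segments, and let
`M` be the maximal cardinality of `I` over all matching functions `(I, f)`.  Then
`#Y − M = min( #{j ∈ {1,…,l} : ⃗Γ_j ≺ Δ_1}, #{i ∈ {1,…,k} : ⃗Γ_l ≺ Δ_i} )`. -/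
theorem speh_Y_minus_max_matching (k l : ℕ) (hk : 1 ≤ k) (hl : 1 ≤ l) (Δ Γ : ℕ → Segment)
    (hΔ : ∀ i, 1 ≤ i → i < k → Δ (i + 1) = (Δ i).shift)
    (hΓ : ∀ j, 1 ≤ j → j < l → Γ (j + 1) = (Γ j).shift) :
    (Yset k l Δ Γ).card - maxMatching k l Δ Γ =
      min ((Finset.Icc 1 l).filter fun j => ((Γ j).shift).prec (Δ 1)).card
          ((Finset.Icc 1 k).filter fun i => ((Γ l).shift).prec (Δ i)).card := by
  have h1 := card_Yset_le_add_first_column hΔ hΓ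
  have h2 := card_Yset_le_add_last_row hΔ hΓ
  rw [← card_filter_Yset_first_column hk, ← card_filter_Yset_last_row hl]
  rcases le_total k l with hkl | hlk
  · have h3 := maxMatching_add_card_le hΔ hΓ (l - k) (fun p => (p.1 - 1, p.2))
      ((Yset k l Δ Γ).filter fun p => p.1 = l) ?_ ?_ ?_
    · omega
    · rintro ⟨r, s⟩ ⟨hX, -⟩ ⟨r', s'⟩ ⟨hX', -⟩ h
      rw [mem_Xset_iff hΔ hΓ] at hX hX'
      simp only [Prod.mk.injEq] at h ⊢
      omega
    · rintro ⟨r, s⟩ hX hc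
      rw [mem_Xset_iff hΔ hΓ] at hX
      simp only [Finset.mem_filter, mem_Yset_iff hΔ hΓ] at hc ⊢
      omega
    · rintro ⟨r, s⟩ h
      simp only [Finset.mem_filter, mem_Yset_iff hΔ hΓ] at h ⊢
      omega
  · have h3 := maxMatching_add_card_le hΔ hΓ 0 (fun p => (p.1, p.2 + 1))
      ((Yset k l Δ Γ).filter fun p => p.2 = 1) ?_ ?_ ?_
    · omega
    · rintro ⟨r, s⟩ - ⟨r', s'⟩ - h
      simp only [Prod.mk.injEq] at h ⊢
      omega
    · rintro ⟨r, s⟩ hX hc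
      rw [mem_Xset_iff hΔ hΓ] at hX
      simp only [Finset.mem_filter, mem_Yset_iff hΔ hΓ] at hc ⊢
      omega
    · rintro ⟨r, s⟩ h
      simp only [Finset.mem_filter, mem_Yset_iff hΔ hΓ] at h ⊢
      omega
end

section
/- Let Δ_1,…,Δ_k and Γ_1,…,Γ_l be Speh families of segments (k, l ≥ 1), with associated sets X, Y, relation ⇝, and let M be the maximum cardinality of I over all matching functions (I,f). Then #X − M = min( #{j ∈ {1,…,l} : Γ_j ≺ Δ_k}, #{i ∈ {1,…,k} : Γ_1 ≺ Δ_i} ). -/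
theorem Segment.shift_prec_shift (Δ Γ : Segment) : Δ.shift.prec Γ.shift ↔ Δ.prec Γ := by
  simp only [Segment.prec, Segment.shift]
  omega

theorem Segment.shift_prec_self (Δ : Segment) : Δ.shift.prec Δ := by
  have := Δ.le
  simp only [Segment.prec, Segment.shift]
  omega

/-- The left endpoints in a Speh family decrease by one at each step. -/
theorem speh_left_endpoint {k : ℕ} {Δ : ℕ → Segment}
    (hΔ : ∀ i, 1 ≤ i → i < k → Δ (i + 1) = (Δ i).shift) {j : ℕ} (h1 : 1 ≤ j) (hk : j ≤ k) :
    (Δ j).a = (Δ 1).a + 1 - j := by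
  induction j, h1 using Nat.le_induction with
  | base => simp
  | succ j hj ih =>
    rw [hΔ j hj (by omega)]
    have := ih (by omega)
    simp only [Segment.shift]
    push_cast
    omega

theorem lt_of_speh_prec {k : ℕ} {Δ : ℕ → Segment}
    (hΔ : ∀ i, 1 ≤ i → i < k → Δ (i + 1) = (Δ i).shift) {s t : ℕ}
    (hs : 1 ≤ s ∧ s ≤ k) (ht : 1 ≤ t ∧ t ≤ k) (h : (Δ s).prec (Δ t)) : t < s := by
  have h1 := speh_left_endpoint hΔ hs.1 hs.2
  have h2 := speh_left_endpoint hΔ ht.1 ht.2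
  have := h.1
  omega

theorem mem_Xset {k l : ℕ} {Δ Γ : ℕ → Segment} {i j : ℕ} :
    (i, j) ∈ Xset k l Δ Γ ↔ ((1 ≤ i ∧ i ≤ l) ∧ 1 ≤ j ∧ j ≤ k) ∧ (Γ i).prec (Δ j) := by
  simp [Xset]

theorem mem_Yset {k l : ℕ} {Δ Γ : ℕ → Segment} {i j : ℕ} :
    (i, j) ∈ Yset k l Δ Γ ↔
      ((1 ≤ i ∧ i ≤ l) ∧ 1 ≤ j ∧ j ≤ k) ∧ (Γ i).shift.prec (Δ j) := by
  simp [Yset]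

theorem mem_Yset_succ_right {k l : ℕ} {Δ Γ : ℕ → Segment}
    (hΔ : ∀ i, 1 ≤ i → i < k → Δ (i + 1) = (Δ i).shift) {i j : ℕ} (h1 : 1 ≤ j) (hk : j < k) :
    (i, j + 1) ∈ Yset k l Δ Γ ↔ (i, j) ∈ Xset k l Δ Γ := by
  rw [mem_Xset, mem_Yset, hΔ j h1 hk, Segment.shift_prec_shift]
  refine and_congr_left fun _ => ?_
  omega

theorem mem_Xset_succ_left {k l : ℕ} {Δ Γ : ℕ → Segment}
    (hΓ : ∀ j, 1 ≤ j → j < l → Γ (j + 1) = (Γ j).shift) {i j : ℕ} (h1 : 1 ≤ i) (hl : i < l) :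
    (i + 1, j) ∈ Xset k l Δ Γ ↔ (i, j) ∈ Yset k l Δ Γ := by
  rw [mem_Xset, mem_Yset, hΓ i h1 hl]
  refine and_congr_left fun _ => ?_
  omega

theorem IsMatching.card_le_Xset {k l : ℕ} {Δ Γ : ℕ → Segment} {I : Finset (ℕ × ℕ)}
    {f : ℕ × ℕ → ℕ × ℕ} (h : IsMatching k l Δ Γ I f) : I.card ≤ (Xset k l Δ Γ).card :=
  Finset.card_le_card h.1

/-- The deficiency bound: if every `Y`-neighbour of `A ⊆ X` lies in `B`, then at least
`#A - #B` elements of `X` are left unmatched. -/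
theorem maxMatching_add_card_le_s8 {k l : ℕ} {Δ Γ : ℕ → Segment} {A B : Finset (ℕ × ℕ)}
    (hA : A ⊆ Xset k l Δ Γ)
    (hB : ∀ p ∈ A, ∀ q ∈ Yset k l Δ Γ, LeadsTo Δ Γ q p → q ∈ B) :
    maxMatching k l Δ Γ + A.card ≤ (Xset k l Δ Γ).card + B.card := by
  have hX : A.card ≤ (Xset k l Δ Γ).card := Finset.card_le_card hA
  suffices h : maxMatching k l Δ Γ ≤ (Xset k l Δ Γ).card - A.card + B.card by omega
  refine csSup_le ⟨0, ∅, id, by simp [IsMatching], rfl⟩ ?_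
  rintro _ ⟨I, f, ⟨hI, hinj, hf⟩, rfl⟩
  have h1 : (I ∩ A).card ≤ B.card := by
    refine Finset.card_le_card_of_injOn f (fun p hp => ?_)
      (hinj.mono (by simp))
    obtain ⟨hpI, hpA⟩ := Finset.mem_inter.1 hp
    exact hB p hpA _ (hf p hpI).1 (hf p hpI).2
  have h2 : (I \ A).card ≤ (Xset k l Δ Γ \ A).card :=
    Finset.card_le_card (Finset.sdiff_subset_sdiff hI le_rfl)
  rw [Finset.card_sdiff_of_subset hA] at h2
  have h3 := Finset.card_inter_add_card_sdiff I A
  omega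

theorem card_Xset_last_column {k l : ℕ} (hk : 1 ≤ k) (Δ Γ : ℕ → Segment) :
    ((Xset k l Δ Γ).filter fun p => p.2 = k).card =
      ((Finset.Icc 1 l).filter fun j => (Γ j).prec (Δ k)).card := by
  refine Finset.card_nbij' Prod.fst (fun i => (i, k)) ?_ ?_ ?_ ?_
  · rintro ⟨i, j⟩ h
    simp only [Finset.coe_filter, Set.mem_ofPred_eq, mem_Xset, Finset.mem_Icc] at h ⊢
    obtain ⟨h, rfl⟩ := h
    exact ⟨h.1.1, h.2⟩
  · intro i h
    simp only [Finset.coe_filter, Set.mem_ofPred_eq, mem_Xset, Finset.mem_Icc] at h ⊢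
    exact ⟨⟨⟨h.1, hk, le_rfl⟩, h.2⟩, trivial⟩
  · rintro ⟨i, j⟩ h
    simp only [Finset.coe_filter, Set.mem_ofPred_eq] at h
    simp [h.2]
  · intro i _
    rfl

theorem card_Xset_first_row {k l : ℕ} (hl : 1 ≤ l) (Δ Γ : ℕ → Segment) :
    ((Xset k l Δ Γ).filter fun p => p.1 = 1).card =
      ((Finset.Icc 1 k).filter fun i => (Γ 1).prec (Δ i)).card := by
  refine Finset.card_nbij' Prod.snd (fun j => (1, j)) ?_ ?_ ?_ ?_
  · rintro ⟨i, j⟩ h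
    simp only [Finset.coe_filter, Set.mem_ofPred_eq, mem_Xset, Finset.mem_Icc] at h ⊢
    obtain ⟨h, rfl⟩ := h
    exact ⟨h.1.2, h.2⟩
  · intro j h
    simp only [Finset.coe_filter, Set.mem_ofPred_eq, mem_Xset, Finset.mem_Icc] at h ⊢
    exact ⟨⟨⟨⟨le_rfl, hl⟩, h.1⟩, h.2⟩, trivial⟩
  · rintro ⟨i, j⟩ h
    simp only [Finset.coe_filter, Set.mem_ofPred_eq] at h
    simp [h.2]
  · intro j _
    rfl

theorem card_Xset_le_maxMatching_add_last_column {k l : ℕ} {Δ Γ : ℕ → Segment}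
    (hΔ : ∀ i, 1 ≤ i → i < k → Δ (i + 1) = (Δ i).shift) :
    (Xset k l Δ Γ).card ≤
      maxMatching k l Δ Γ + ((Xset k l Δ Γ).filter fun p => p.2 = k).card := by
  have hM : IsMatching k l Δ Γ ((Xset k l Δ Γ).filter fun p => ¬ p.2 = k)
      (fun p => (p.1, p.2 + 1)) := by
    refine ⟨Finset.filter_subset _ _, ?_, ?_⟩
    · rintro ⟨i, j⟩ _ ⟨i', j'⟩ _ h
      simpa using h
    · rintro ⟨i, j⟩ hp
      obtain ⟨hX, hj⟩ := Finset.mem_filter.1 hp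
      have hb := (mem_Xset.1 hX).1.2
      have hjk : j < k := lt_of_le_of_ne hb.2 hj
      refine ⟨(mem_Yset_succ_right hΔ hb.1 hjk).2 hX, Or.inl ⟨rfl, ?_⟩⟩
      simpa only [hΔ j hb.1 hjk] using (Δ j).shift_prec_self
  have h1 := hM.card_le_maxMatching
  have h2 := Finset.card_filter_add_card_filter_not (s := Xset k l Δ Γ) (fun p => p.2 = k)
  omega

theorem card_Xset_le_maxMatching_add_first_row {k l : ℕ} {Δ Γ : ℕ → Segment}
    (hΓ : ∀ j, 1 ≤ j → j < l → Γ (j + 1) = (Γ j).shift) :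
    (Xset k l Δ Γ).card ≤
      maxMatching k l Δ Γ + ((Xset k l Δ Γ).filter fun p => p.1 = 1).card := by
  have hM : IsMatching k l Δ Γ ((Xset k l Δ Γ).filter fun p => ¬ p.1 = 1)
      (fun p => (p.1 - 1, p.2)) := by
    refine ⟨Finset.filter_subset _ _, ?_, ?_⟩
    · rintro ⟨i, j⟩ hp ⟨i', j'⟩ hp' h
      have hi := (mem_Xset.1 (Finset.mem_filter.1 hp).1).1.1
      have hi' := (mem_Xset.1 (Finset.mem_filter.1 hp').1).1.1
      simp only [Prod.mk.injEq] at h ⊢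
      omega
    · rintro ⟨i, j⟩ hp
      obtain ⟨hX, hi⟩ := Finset.mem_filter.1 hp
      have hb := (mem_Xset.1 hX).1.1
      obtain ⟨i, rfl⟩ : ∃ m, i = m + 1 := ⟨i - 1, by omega⟩
      have hi1 : 1 ≤ i := by simp only at hi; omega
      refine ⟨(mem_Xset_succ_left hΓ hi1 (by omega)).1 hX, Or.inr ⟨rfl, ?_⟩⟩
      simpa only [hΓ i hi1 (by omega), Nat.add_sub_cancel] using (Γ i).shift_prec_self
  have h1 := hM.card_le_maxMatching
  have h2 := Finset.card_filter_add_card_filter_not (s := Xset k l Δ Γ) (fun p => p.1 = 1)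
  omega

/-- A cell of `Y` leading to a cell of `X` lies on a diagonal strictly further from the
bottom left corner. -/
theorem LeadsTo.diagonal_lt {k l : ℕ} {Δ Γ : ℕ → Segment}
    (hΔ : ∀ i, 1 ≤ i → i < k → Δ (i + 1) = (Δ i).shift)
    (hΓ : ∀ j, 1 ≤ j → j < l → Γ (j + 1) = (Γ j).shift) {p q : ℕ × ℕ}
    (hp : p ∈ Xset k l Δ Γ) (hq : q ∈ Yset k l Δ Γ) (h : LeadsTo Δ Γ q p) :
    p.2 + q.1 < q.2 + p.1 := by
  have hp := (mem_Xset.1 hp).1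
  have hq := (mem_Yset.1 hq).1
  rcases h with ⟨h1, h2⟩ | ⟨h1, h2⟩
  · have := lt_of_speh_prec hΔ hq.2 hp.2 h2
    omega
  · have := lt_of_speh_prec hΓ hp.1 hq.1 h2
    omega

theorem maxMatching_add_last_column_le {k l : ℕ} {Δ Γ : ℕ → Segment} (hlk : l ≤ k)
    (hΔ : ∀ i, 1 ≤ i → i < k → Δ (i + 1) = (Δ i).shift)
    (hΓ : ∀ j, 1 ≤ j → j < l → Γ (j + 1) = (Γ j).shift) :
    maxMatching k l Δ Γ + ((Xset k l Δ Γ).filter fun p => p.2 = k).card ≤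
      (Xset k l Δ Γ).card := by
  set A := (Xset k l Δ Γ).filter fun p => k + p.1 ≤ p.2 + l with hA
  set B := (Yset k l Δ Γ).filter fun p => k + p.1 < p.2 + l
  have h1 : maxMatching k l Δ Γ + A.card ≤ (Xset k l Δ Γ).card + B.card := by
    refine maxMatching_add_card_le_s8 (Finset.filter_subset _ _) fun p hp q hq h => ?_
    obtain ⟨hpX, hp⟩ := Finset.mem_filter.1 hp
    have := h.diagonal_lt hΔ hΓ hpX hq
    exact Finset.mem_filter.2 ⟨hq, by omega⟩
  have h2 := Finset.card_filter_add_card_filter_not (s := A) (fun p => p.2 = k)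
  have h3 : B.card ≤ (A.filter fun p => ¬ p.2 = k).card := by
    refine Finset.card_le_card_of_injOn (fun p => (p.1, p.2 - 1)) ?_ ?_
    · rintro ⟨i, j⟩ hp
      obtain ⟨hY, hp⟩ := Finset.mem_filter.1 hp
      have hb := (mem_Yset.1 hY).1
      obtain ⟨j, rfl⟩ : ∃ m, j = m + 1 := ⟨j - 1, by omega⟩
      simp only at hp
      have hX := (mem_Yset_succ_right hΔ (by omega) (by omega)).1 hY
      simp only [hA, Finset.coe_filter, Finset.mem_filter, Set.mem_ofPred_eq,
        Nat.add_sub_cancel]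
      exact ⟨⟨hX, by omega⟩, by omega⟩
    · rintro ⟨i, j⟩ hp ⟨i', j'⟩ hp' h
      have hj := (mem_Yset.1 (Finset.mem_filter.1 hp).1).1.2
      have hj' := (mem_Yset.1 (Finset.mem_filter.1 hp').1).1.2
      simp only [Prod.mk.injEq] at h ⊢
      omega
  have h4 : ((Xset k l Δ Γ).filter fun p => p.2 = k).card ≤
      (A.filter fun p => p.2 = k).card := by
    refine Finset.card_le_card fun p hp => ?_
    obtain ⟨hX, hp⟩ := Finset.mem_filter.1 hp
    have hb := (mem_Xset.1 hX).1
    exact Finset.mem_filter.2 ⟨Finset.mem_filter.2 ⟨hX, by omega⟩, hp⟩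
  omega

theorem maxMatching_add_first_row_le {k l : ℕ} {Δ Γ : ℕ → Segment} (hkl : k ≤ l)
    (hΔ : ∀ i, 1 ≤ i → i < k → Δ (i + 1) = (Δ i).shift)
    (hΓ : ∀ j, 1 ≤ j → j < l → Γ (j + 1) = (Γ j).shift) :
    maxMatching k l Δ Γ + ((Xset k l Δ Γ).filter fun p => p.1 = 1).card ≤
      (Xset k l Δ Γ).card := by
  set A := (Xset k l Δ Γ).filter fun p => p.1 ≤ p.2 with hA
  set B := (Yset k l Δ Γ).filter fun p => p.1 < p.2
  have h1 : maxMatching k l Δ Γ + A.card ≤ (Xset k l Δ Γ).card + B.card := by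
    refine maxMatching_add_card_le_s8 (Finset.filter_subset _ _) fun p hp q hq h => ?_
    obtain ⟨hpX, hp⟩ := Finset.mem_filter.1 hp
    have := h.diagonal_lt hΔ hΓ hpX hq
    exact Finset.mem_filter.2 ⟨hq, by omega⟩
  have h2 := Finset.card_filter_add_card_filter_not (s := A) (fun p => p.1 = 1)
  have h3 : B.card ≤ (A.filter fun p => ¬ p.1 = 1).card := by
    refine Finset.card_le_card_of_injOn (fun p => (p.1 + 1, p.2)) ?_ ?_
    · rintro ⟨i, j⟩ hp
      obtain ⟨hY, hp⟩ := Finset.mem_filter.1 hp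
      have hb := (mem_Yset.1 hY).1
      simp only at hp
      have hX := (mem_Xset_succ_left hΓ (by omega) (by omega)).2 hY
      simp only [hA, Finset.coe_filter, Finset.mem_filter, Set.mem_ofPred_eq]
      exact ⟨⟨hX, by omega⟩, by omega⟩
    · rintro ⟨i, j⟩ _ ⟨i', j'⟩ _ h
      simpa using h
  have h4 : ((Xset k l Δ Γ).filter fun p => p.1 = 1).card ≤
      (A.filter fun p => p.1 = 1).card := by
    refine Finset.card_le_card fun p hp => ?_
    obtain ⟨hX, hp⟩ := Finset.mem_filter.1 hp
    have hb := (mem_Xset.1 hX).1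
    exact Finset.mem_filter.2 ⟨Finset.mem_filter.2 ⟨hX, by omega⟩, hp⟩
  omega

/-- Let `Δ_1, …, Δ_k` and `Γ_1, …, Γ_l` (`k, l ≥ 1`) be Speh families of segments, and let
`M` be the maximal cardinality of `I` over all matching functions `(I, f)`.  Then
`#X − M = min( #{j ∈ {1,…,l} : Γ_j ≺ Δ_k}, #{i ∈ {1,…,k} : Γ_1 ≺ Δ_i} )`. -/
theorem speh_X_minus_max_matching (k l : ℕ) (hk : 1 ≤ k) (hl : 1 ≤ l) (Δ Γ : ℕ → Segment)
    (hΔ : ∀ i, 1 ≤ i → i < k → Δ (i + 1) = (Δ i).shift)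
    (hΓ : ∀ j, 1 ≤ j → j < l → Γ (j + 1) = (Γ j).shift) :
    (Xset k l Δ Γ).card - maxMatching k l Δ Γ =
      min ((Finset.Icc 1 l).filter fun j => (Γ j).prec (Δ k)).card
          ((Finset.Icc 1 k).filter fun i => (Γ 1).prec (Δ i)).card := by
  rw [← card_Xset_last_column hk, ← card_Xset_first_row hl]
  have h1 := card_Xset_le_maxMatching_add_last_column (l := l) (Γ := Γ) hΔ
  have h2 := card_Xset_le_maxMatching_add_first_row (k := k) (Δ := Δ) hΓ
  rcases le_total l k with h | h
  · have := maxMatching_add_last_column_le h hΔ hΓ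
    omega
  · have := maxMatching_add_first_row_le h hΔ hΓ
    omega
end
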